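/- arXiv:0801.1462 — 3 statements merged into one kernel-verified Lean document; each statement's English description precedes it below -/
import Mathlib

section
/- Let R be a ring and G a class of left R-modules. Suppose F = {M : Ext^i_R(M, G) = 0 for all 1 ≤ i ≤ m and all G ∈ G} equals {M : Ext^i_R(M, G) = 0 for all i ≥ 1 and all G ∈ G}. Then F defines a homological dimension. -/
open CategoryTheory

universe u

noncomputable section

variable {R : Type u} [Ring R]

/-- Membership in `F ∪ {0}`. -/
def MemF0 (F : ModuleCat.{u} R → Prop) (M : ModuleCat.{u} R) : Prop :=
  F M ∨ Subsingleton M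

/-- There is a short exact sequence `0 → A → B → C → 0`. -/
def IsSES {R : Type u} [Ring R] (A B C : ModuleCat.{u} R) : Prop :=
  ∃ (f : A ⟶ B) (g : B ⟶ C),
    Function.Injective f ∧ Function.Surjective g ∧ Function.Exact f g

/-- `FDimLE F n M` : `M` has left `F`-dimension `≤ n`, i.e. there is an exact sequence
`0 → F_n → ⋯ → F_0 → M → 0` with all `F_j ∈ F ∪ {0}`. -/
def FDimLE (F : ModuleCat.{u} R → Prop) : ℕ → ModuleCat.{u} R → Prop
  | 0, M => MemF0 F M
  | n + 1, M => ∃ K F0 : ModuleCat.{u} R, MemF0 F F0 ∧ IsSES K F0 M ∧ FDimLE F n K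

/-- `M` admits a (possibly infinite) `F`-resolution `⋯ → F_1 → F_0 → M → 0`
with all terms in `F ∪ {0}`. -/
def HasFRes (F : ModuleCat.{u} R → Prop) (M : ModuleCat.{u} R) : Prop :=
  ∃ K Fo : ℕ → ModuleCat.{u} R, K 0 = M ∧
    ∀ n, MemF0 F (Fo n) ∧ IsSES (K (n + 1)) (Fo n) (K n)

/-- `IsFKernel F n K X` : there is an exact sequence
`0 → K → F_n → ⋯ → F_0 → X → 0` with all `F_i ∈ F`. -/
def IsFKernel (F : ModuleCat.{u} R → Prop) : ℕ → ModuleCat.{u} R → ModuleCat.{u} R → Prop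
  | 0, K, X => ∃ F0, F F0 ∧ IsSES K F0 X
  | n + 1, K, X => ∃ K1 F0, F F0 ∧ IsSES K1 F0 X ∧ IsFKernel F n K K1

/-- The class `F` defines a homological dimension. -/
def DefinesHomDim (F : ModuleCat.{u} R → Prop) : Prop :=
  (∀ K Fm M : ModuleCat.{u} R, F Fm → IsSES K Fm M → HasFRes F M → HasFRes F K) ∧
  (∀ (n : ℕ) (K X : ModuleCat.{u} R), FDimLE F (n + 1) X → IsFKernel F n K X → F K)

/-- `M` is a homomorphic image of a module in `F`. -/
def IsImageOfF (F : ModuleCat.{u} R → Prop) (M : ModuleCat.{u} R) : Prop :=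
  ∃ F0 : ModuleCat.{u} R, F F0 ∧ ∃ g : F0 ⟶ M, Function.Surjective g

/-- `F` is closed under finite (binary) direct sums. -/
def ClosedUnderFinSums (F : ModuleCat.{u} R → Prop) : Prop :=
  ∀ A B : ModuleCat.{u} R, F A → F B → F (ModuleCat.of R (A × B))

/-- The class of homomorphic images of modules in `F` is closed under extensions. -/
def ImagesClosedUnderExt (F : ModuleCat.{u} R → Prop) : Prop :=
  ∀ (A B C : ModuleCat.{u} R) (f : A ⟶ B) (g : B ⟶ C),
    Function.Injective f → Function.Surjective g → Function.Exact f g →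
      IsImageOfF F A → IsImageOfF F C → IsImageOfF F B

/-- `Ext^i(M, N)` vanishes. -/
def ExtZero {R : Type u} [Ring R] (i : ℕ) (M N : ModuleCat.{u} R) : Prop :=
  Subsingleton (((Ext ℤ (ModuleCat.{u} R) i).obj (Opposite.op M)).obj N)

end
/-- Vanishing of the derived functor `Ext` in terms of the derived-category `Ext`. -/
theorem extZero_iff {R : Type u} [Ring R] (i : ℕ) (M N : ModuleCat.{u} R) :
    ExtZero (i + 1) M N ↔ Subsingleton (Abelian.Ext.{u} M N (i + 1)) := by
  have P : ProjectiveResolution M := projectiveResolution M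
  have h1 : ExtZero (i + 1) M N ↔ ∀ f : P.complex.X (i + 1) ⟶ N,
      P.complex.d (i + 2) (i + 1) ≫ f = 0 → ∃ g : P.complex.X i ⟶ N,
        P.complex.d (i + 1) i ≫ g = f := by
    unfold ExtZero
    rw [← ModuleCat.isZero_iff_subsingleton, (P.isoExt (R := ℤ) (i + 1) N).isZero_iff,
      ← HomologicalComplex.exactAt_iff_isZero_homology,
      HomologicalComplex.exactAt_iff' _ i (i + 1) (i + 2) (by simp) (by simp),
      ShortComplex.moduleCat_exact_iff]
    rfl
  have h2 : Subsingleton (Abelian.Ext.{u} M N (i + 1)) ↔ ∀ f : P.complex.X (i + 1) ⟶ N,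
      P.complex.d (i + 2) (i + 1) ≫ f = 0 → ∃ g : P.complex.X i ⟶ N,
        P.complex.d (i + 1) i ≫ g = f := by
    constructor
    · intro h f hf
      exact (P.extMk_eq_zero_iff f (i + 2) rfl hf i rfl).1 (Subsingleton.elim _ _)
    · intro h
      refine subsingleton_of_forall_eq 0 fun α => ?_
      obtain ⟨f, hf, rfl⟩ := P.extMk_surjective α (i + 2) rfl
      exact (P.extMk_eq_zero_iff f (i + 2) rfl hf i rfl).2 (h f hf)
  rw [h1, h2]

theorem IsSES.exists_shortExact {R : Type u} [Ring R] {A B C : ModuleCat.{u} R}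
    (h : IsSES A B C) : ∃ S : ShortComplex (ModuleCat.{u} R),
      S.ShortExact ∧ S.X₁ = A ∧ S.X₂ = B ∧ S.X₃ = C := by
  obtain ⟨f, g, hf, hg, hfg⟩ := h
  have w : f ≫ g = 0 := by
    ext x
    exact (hfg (f x)).2 ⟨x, rfl⟩
  refine ⟨ShortComplex.mk f g w, ?_, rfl, rfl, rfl⟩
  have : Mono f := (ModuleCat.mono_iff_injective f).2 hf
  have : Epi g := (ModuleCat.epi_iff_surjective g).2 hg
  exact ⟨(ShortComplex.moduleCat_exact_iff _).2 fun x hx => (hfg x).1 hx⟩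

theorem ext_left_zero {R : Type u} [Ring R] {A B C N : ModuleCat.{u} R}
    (h : IsSES A B C) (i : ℕ) (hB : ExtZero (i + 1) B N) (hC : ExtZero (i + 2) C N) :
    ExtZero (i + 1) A N := by
  obtain ⟨S, hS, rfl, rfl, rfl⟩ := h.exists_shortExact
  rw [extZero_iff] at *
  refine subsingleton_of_forall_eq 0 fun x => ?_
  obtain ⟨y, rfl⟩ := Abelian.Ext.contravariant_sequence_exact₁ hS N x
    (add_comm 1 (i + 1)) (Subsingleton.elim _ _)
  rw [Subsingleton.elim y 0, Abelian.Ext.comp_zero]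

theorem ext_right_zero {R : Type u} [Ring R] {A B C N : ModuleCat.{u} R}
    (h : IsSES A B C) (i : ℕ) (hA : ExtZero (i + 1) A N) (hB : ExtZero (i + 2) B N) :
    ExtZero (i + 2) C N := by
  obtain ⟨S, hS, rfl, rfl, rfl⟩ := h.exists_shortExact
  rw [extZero_iff] at *
  refine subsingleton_of_forall_eq 0 fun x => ?_
  obtain ⟨y, rfl⟩ := Abelian.Ext.contravariant_sequence_exact₃ hS N x
    (Subsingleton.elim _ _) (add_comm 1 (i + 1))
  rw [Subsingleton.elim y 0, Abelian.Ext.comp_zero]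

theorem extZero_of_projective {R : Type u} [Ring R] (M N : ModuleCat.{u} R)
    [Projective M] (i : ℕ) : ExtZero (i + 1) M N :=
  ModuleCat.subsingleton_of_isZero (isZero_Ext_succ_of_projective M N i)

theorem extZero_of_subsingleton {R : Type u} [Ring R] (M N : ModuleCat.{u} R)
    [Subsingleton M] (i : ℕ) : ExtZero (i + 1) M N := by
  have : Projective M := (ModuleCat.isZero_of_subsingleton M).projective
  exact extZero_of_projective M N i

/-- A first syzygy. -/
theorem exists_syzygy {R : Type u} [Ring R] (M : ModuleCat.{u} R) :
    ∃ K P : ModuleCat.{u} R, Projective P ∧ IsSES K P M := by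
  let g := Projective.π M
  refine ⟨ModuleCat.of R (LinearMap.ker g.hom), Projective.over M, inferInstance,
    ModuleCat.ofHom (LinearMap.ker g.hom).subtype, g, Subtype.val_injective,
    (ModuleCat.epi_iff_surjective g).1 inferInstance, ?_⟩
  intro x
  constructor
  · intro hx
    exact ⟨⟨x, hx⟩, rfl⟩
  · rintro ⟨y, rfl⟩
    exact y.2

theorem hasFRes_of_projective {R : Type u} [Ring R] (F : ModuleCat.{u} R → Prop)
    (hF : ∀ P : ModuleCat.{u} R, Projective P → F P) (M : ModuleCat.{u} R) :
    HasFRes F M := by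
  choose K P hP hS using (exists_syzygy (R := R))
  refine ⟨fun n => K^[n] M, fun n => P (K^[n] M), rfl, fun n => ⟨Or.inl (hF _ (hP _)), ?_⟩⟩
  simp only [Function.iterate_succ_apply']
  exact hS _

theorem ext_of_fdim {R : Type u} [Ring R] (F : ModuleCat.{u} R → Prop) (N : ModuleCat.{u} R)
    (hF : ∀ M, F M → ∀ i, ExtZero (i + 1) M N) (n : ℕ) :
    ∀ X, FDimLE F n X → ∀ i, ExtZero (n + i + 1) X N := by
  have h0 : ∀ M, MemF0 F M → ∀ i, ExtZero (i + 1) M N := by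
    rintro M (h | h) i
    · exact hF M h i
    · exact extZero_of_subsingleton M N i
  induction n with
  | zero => exact fun X hX i => h0 X hX _
  | succ n ih =>
    rintro X ⟨K, F0, hF0, hS, hK⟩ i
    have := ext_right_zero hS (n + i) (ih K hK i) (h0 F0 hF0 _)
    rwa [show n + 1 + i + 1 = n + i + 2 by omega]

theorem ext_of_kernel {R : Type u} [Ring R] (F : ModuleCat.{u} R → Prop) (N : ModuleCat.{u} R)
    (hF : ∀ M, F M → ∀ i, ExtZero (i + 1) M N) (n : ℕ) :
    ∀ K X, IsFKernel F n K X → (∀ i, ExtZero (n + 1 + i + 1) X N) →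
      ∀ i, ExtZero (i + 1) K N := by
  induction n with
  | zero =>
    rintro K X ⟨F0, hF0, hS⟩ hX i
    refine ext_left_zero hS i (hF _ hF0 _) ?_
    have := hX i
    rwa [show 0 + 1 + i + 1 = i + 2 by omega] at this
  | succ n ih =>
    rintro K X ⟨K1, F0, hF0, hS, hK⟩ hX i
    refine ih K K1 hK (fun j => ext_left_zero hS _ (hF _ hF0 _) ?_) i
    have := hX j
    rwa [show n + 1 + 1 + j + 1 = n + 1 + j + 2 by omega] at this

theorem stmt8 {R : Type u} [Ring R] (G : ModuleCat.{u} R → Prop) (m : ℕ) (hm : 1 ≤ m)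
    (heq : ∀ M : ModuleCat.{u} R,
      (∀ i, 1 ≤ i → i ≤ m → ∀ g, G g → ExtZero i M g) ↔
      (∀ i, 1 ≤ i → ∀ g, G g → ExtZero i M g)) :
    DefinesHomDim (fun M : ModuleCat.{u} R =>
      ∀ i, 1 ≤ i → i ≤ m → ∀ g, G g → ExtZero i M g) := by
  have hF : ∀ N, G N → ∀ M : ModuleCat.{u} R,
      (∀ i, 1 ≤ i → i ≤ m → ∀ g, G g → ExtZero i M g) → ∀ i, ExtZero (i + 1) M N :=
    fun N hN M hM i => (heq M).1 hM (i + 1) (by omega) N hN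
  refine ⟨fun K _ _ _ _ _ => hasFRes_of_projective _ ?_ K, ?_⟩
  · intro P hP i hi _ g _
    obtain ⟨j, rfl⟩ := Nat.exists_eq_add_of_le' hi
    exact extZero_of_projective P g j
  · intro n K X hX hK i hi _ g hg
    obtain ⟨j, rfl⟩ := Nat.exists_eq_add_of_le' hi
    exact ext_of_kernel _ g (hF g hg) n K X hK (ext_of_fdim _ g (hF g hg) (n + 1) X hX) j
end

section
/- Let R be a ring and F a class of left R-modules defining a homological dimension, closed under finite direct sums, such that every module is a quotient of a module in F. Then for every i ≥ 1, the class F_i of modules of F-dimension ≤ i also defines a homological dimension. -/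
open CategoryTheory

universe u

namespace HD

variable {R : Type u} [Ring R]

theorem ses_mk {A B C : Type u} [AddCommGroup A] [AddCommGroup B] [AddCommGroup C]
    [Module R A] [Module R B] [Module R C] (f : A →ₗ[R] B) (g : B →ₗ[R] C)
    (hf : Function.Injective f) (hg : Function.Surjective g) (h : Function.Exact f g) :
    IsSES (ModuleCat.of R A) (ModuleCat.of R B) (ModuleCat.of R C) :=
  ⟨ModuleCat.ofHom f, ModuleCat.ofHom g, hf, hg, h⟩

theorem ses_elim {A B C : ModuleCat.{u} R} (h : IsSES A B C) :
    ∃ (f : A →ₗ[R] B) (g : B →ₗ[R] C),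
      Function.Injective f ∧ Function.Surjective g ∧ Function.Exact f g := by
  obtain ⟨f, g, h1, h2, h3⟩ := h
  exact ⟨f.hom, g.hom, h1, h2, h3⟩

theorem ses_ker {B C : Type u} [AddCommGroup B] [AddCommGroup C]
    [Module R B] [Module R C] (g : B →ₗ[R] C) (hg : Function.Surjective g) :
    IsSES (ModuleCat.of R (LinearMap.ker g)) (ModuleCat.of R B) (ModuleCat.of R C) :=
  ses_mk (LinearMap.ker g).subtype g Subtype.val_injective hg
    (LinearMap.exact_subtype_ker_map g)

theorem ses_zero_left (M : ModuleCat.{u} R) : IsSES (ModuleCat.of R PUnit.{u+1}) M M :=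
  ses_mk (R := R) (A := PUnit.{u+1}) 0 (LinearMap.id : M →ₗ[R] M)
    (fun _ _ _ => rfl) Function.surjective_id (by
      intro y
      constructor
      · intro h; exact ⟨0, by simpa using h.symm⟩
      · rintro ⟨x, rfl⟩; simp)

theorem ses_zero_right {A B : ModuleCat.{u} R} (e : A ≃ₗ[R] B) (Z : ModuleCat.{u} R)
    [Subsingleton Z] : IsSES A B Z :=
  ses_mk (e : A →ₗ[R] B) (0 : B →ₗ[R] Z) e.injective (fun z => ⟨0, Subsingleton.elim _ _⟩) (by
      intro y
      constructor
      · intro h; exact ⟨e.symm y, by simp⟩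
      · rintro ⟨x, rfl⟩; simp)

theorem zero_dim (F : ModuleCat.{u} R → Prop) (n : ℕ) :
    ∀ M : ModuleCat.{u} R, Subsingleton M → FDimLE F n M := by
  induction n with
  | zero => intro M h; exact Or.inr h
  | succ n ih =>
    intro M h
    exact ⟨_, M, Or.inr h, ses_zero_left M, ih _ (inferInstanceAs (Subsingleton PUnit))⟩

theorem dim_of_mem (F : ModuleCat.{u} R → Prop) (n : ℕ) (M : ModuleCat.{u} R) (h : MemF0 F M) :
    FDimLE F n M := by
  cases n with
  | zero => exact h
  | succ n =>
    exact ⟨_, M, h, ses_zero_left M, zero_dim F n _ (inferInstanceAs (Subsingleton PUnit))⟩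

theorem dim_succ (F : ModuleCat.{u} R → Prop) (n : ℕ) :
    ∀ M : ModuleCat.{u} R, FDimLE F n M → FDimLE F (n + 1) M := by
  induction n with
  | zero => intro M h; exact dim_of_mem F 1 M h
  | succ n ih =>
    rintro M ⟨K, F0, h0, hs, hK⟩
    exact ⟨K, F0, h0, hs, ih K hK⟩

theorem dim_mono (F : ModuleCat.{u} R → Prop) {m n : ℕ} (h : m ≤ n) (M : ModuleCat.{u} R)
    (hM : FDimLE F m M) : FDimLE F n M := by
  induction h with
  | refl => exact hM
  | step _ ih => exact dim_succ F _ M ih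

section

variable {F : ModuleCat.{u} R → Prop}

theorem mem_iso (hF : DefinesHomDim F) {A B : ModuleCat.{u} R} (e : A ≃ₗ[R] B) (h : F B) : F A := by
  have hs : Subsingleton (ModuleCat.of R PUnit.{u+1}) := inferInstanceAs (Subsingleton PUnit)
  exact hF.2 0 A (ModuleCat.of R PUnit.{u+1}) (zero_dim F 1 _ hs) ⟨B, h, ses_zero_right e _⟩

theorem mem_zero (hF : DefinesHomDim F)
    (hall : ∀ M : ModuleCat.{u} R, IsImageOfF F M)
    (Z : ModuleCat.{u} R) (hZ : Subsingleton Z) : F Z := by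
  obtain ⟨M, hM, -⟩ := hall Z
  have h := hF.2 0 _ M (dim_of_mem F 1 M (Or.inl hM)) ⟨M, hM, ses_zero_left M⟩
  refine mem_iso hF (B := ModuleCat.of R PUnit.{u+1}) ?_ h
  exact
    { (0 : Z →ₗ[R] PUnit.{u+1}) with
      invFun := fun _ => 0
      left_inv := fun x => Subsingleton.elim _ _
      right_inv := fun x => rfl }

theorem mem_of0 (hF : DefinesHomDim F)
    (hall : ∀ M : ModuleCat.{u} R, IsImageOfF F M)
    (M : ModuleCat.{u} R) (h : MemF0 F M) : F M :=
  h.elim id (mem_zero hF hall M)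

theorem exists_kernel (hall : ∀ M : ModuleCat.{u} R, IsImageOfF F M)
    (n : ℕ) : ∀ X : ModuleCat.{u} R, ∃ K, IsFKernel F n K X := by
  induction n with
  | zero =>
    intro X
    obtain ⟨F0, h0, g, hg⟩ := hall X
    exact ⟨_, F0, h0, ses_ker g.hom hg⟩
  | succ n ih =>
    intro X
    obtain ⟨F0, h0, g, hg⟩ := hall X
    obtain ⟨K, hK⟩ := ih (ModuleCat.of R (LinearMap.ker g.hom))
    exact ⟨K, _, F0, h0, ses_ker g.hom hg, hK⟩

theorem dim_of_kernel (n : ℕ) : ∀ K X : ModuleCat.{u} R, IsFKernel F n K X → F K →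
    FDimLE F (n + 1) X := by
  induction n with
  | zero =>
    rintro K X ⟨F0, h0, hs⟩ hK
    exact ⟨K, F0, Or.inl h0, hs, Or.inl hK⟩
  | succ n ih =>
    rintro K X ⟨K1, F0, h0, hs, hk⟩ hK
    exact ⟨K1, F0, Or.inl h0, hs, ih K K1 hk hK⟩

theorem dim_ker (hF : DefinesHomDim F)
    (hall : ∀ M : ModuleCat.{u} R, IsImageOfF F M)
    (n : ℕ) (K F0 X : ModuleCat.{u} R) (h0 : F F0) (hs : IsSES K F0 X)
    (hX : FDimLE F (n + 1) X) : FDimLE F n K := by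
  cases n with
  | zero => exact Or.inl (hF.2 0 K X hX ⟨F0, h0, hs⟩)
  | succ n =>
    obtain ⟨K', hK'⟩ := exists_kernel hall n K
    exact dim_of_kernel n K' K hK' (hF.2 (n + 1) K' X hX ⟨K, F0, h0, hs, hK'⟩)

theorem ses_kernels {A B C P Q : ModuleCat.{u} R} (f : A →ₗ[R] B) (g : B →ₗ[R] C)
    (hf : Function.Injective f) (hfg : Function.Exact f g)
    (p : P →ₗ[R] A) (hp : Function.Surjective p) (q : Q →ₗ[R] B) :
    IsSES (ModuleCat.of R (LinearMap.ker p))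
      (ModuleCat.of R (LinearMap.ker ((f ∘ₗ p).coprod q)))
      (ModuleCat.of R (LinearMap.ker (g ∘ₗ q))) := by
  have hgf : ∀ a, g (f a) = 0 := fun a => (hfg _).2 ⟨a, rfl⟩
  refine ses_mk
    (((LinearMap.inl R P Q) ∘ₗ (LinearMap.ker p).subtype).codRestrict _ ?_)
    (((LinearMap.snd R P Q) ∘ₗ
      (LinearMap.ker ((f ∘ₗ p).coprod q)).subtype).codRestrict _ ?_) ?_ ?_ ?_
  · rintro ⟨x, hx⟩
    have hx' : p x = 0 := hx
    simp [hx']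
  · rintro ⟨⟨x, y⟩, h⟩
    have h' : f (p x) + q y = 0 := by simpa using h
    have h2 := congrArg g h'
    simpa [hgf] using h2
  · rintro ⟨x, hx⟩ ⟨y, hy⟩ h
    have := congrArg (fun z => z.1.1) h
    exact Subtype.ext this
  · rintro ⟨y, hy⟩
    have hy' : g (q y) = 0 := hy
    obtain ⟨a, ha⟩ := (hfg _).1 hy'
    obtain ⟨x, rfl⟩ := hp a
    refine ⟨⟨(-x, y), ?_⟩, rfl⟩
    simp [ha]
  · rintro ⟨⟨x, y⟩, h⟩
    have h' : f (p x) + q y = 0 := by simpa using h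
    constructor
    · intro h0
      have hy : y = 0 := congrArg Subtype.val h0
      subst hy
      have hx : p x = 0 := hf (by simpa using h')
      exact ⟨⟨x, hx⟩, rfl⟩
    · rintro ⟨⟨x', hx'⟩, h2⟩
      have : (0 : Q) = y := congrArg (fun z => z.1.2) h2
      exact Subtype.ext this.symm

theorem ses_kernels2 {A B C P : ModuleCat.{u} R} (f : A →ₗ[R] B) (g : B →ₗ[R] C)
    (hf : Function.Injective f) (hfg : Function.Exact f g)
    (p : P →ₗ[R] B) (hp : Function.Surjective p) :
    IsSES (ModuleCat.of R (LinearMap.ker p)) (ModuleCat.of R (LinearMap.ker (g ∘ₗ p))) A := by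
  have hgf : ∀ a, g (f a) = 0 := fun a => (hfg _).2 ⟨a, rfl⟩
  let e := LinearEquiv.ofInjective f hf
  let r : LinearMap.ker (g ∘ₗ p) →ₗ[R] LinearMap.range f :=
    (p ∘ₗ (LinearMap.ker (g ∘ₗ p)).subtype).codRestrict _ (fun x => (hfg _).1 x.2)
  have hr : ∀ x, f (e.symm (r x)) = p x.1 := by
    intro x
    have : e (e.symm (r x)) = r x := e.apply_symm_apply _
    exact congrArg Subtype.val this
  refine ses_mk (A := LinearMap.ker p) (B := LinearMap.ker (g ∘ₗ p)) (C := A)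
    ((LinearMap.ker p).subtype.codRestrict _ ?_) ((e.symm : _ →ₗ[R] A) ∘ₗ r) ?_ ?_ ?_
  · rintro ⟨x, hx⟩
    have hx' : p x = 0 := hx
    simp [hx']
  · rintro ⟨x, hx⟩ ⟨y, hy⟩ h
    have := congrArg (fun z => z.1) h
    exact Subtype.ext this
  · intro a
    obtain ⟨x, hx⟩ := hp (f a)
    refine ⟨⟨x, ?_⟩, hf ?_⟩
    · simp [hx, hgf]
    · exact (hr _).trans hx
  · intro x
    constructor
    · intro h
      have h1 : e.symm (r x) = 0 := h
      have h2 := hr x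
      rw [h1, map_zero] at h2
      exact ⟨⟨x.1, h2.symm⟩, rfl⟩
    · rintro ⟨⟨y, hy⟩, rfl⟩
      apply hf
      exact (hr _).trans (by simpa using hy)

theorem dim_quot (hF : DefinesHomDim F)
    (hall : ∀ M : ModuleCat.{u} R, IsImageOfF F M)
    (hsum : ClosedUnderFinSums F) (j : ℕ) : ∀ A B C : ModuleCat.{u} R,
    IsSES A B C → FDimLE F j A → FDimLE F (j + 1) B → FDimLE F (j + 1) C := by
  induction j with
  | zero =>
    intro A B C hs hA hB
    obtain ⟨f, g, hf, hg, hfg⟩ := ses_elim hs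
    have hA' := mem_of0 hF hall A hA
    obtain ⟨Q, hQ, q, hq⟩ := hall B
    have hk := ses_kernels f g hf hfg LinearMap.id Function.surjective_id q.hom
    have hB' := dim_ker hF hall 0 _ _ B (hsum A Q hA' hQ)
      (ses_ker ((f ∘ₗ LinearMap.id).coprod q.hom)
        (fun b => by obtain ⟨y, hy⟩ := hq b; exact ⟨(0, y), by simpa using hy⟩)) hB
    refine ⟨_, Q, Or.inl hQ, ses_ker (g ∘ₗ q.hom) (hg.comp hq), ?_⟩
    obtain ⟨f', g', hf', hg', hfg'⟩ := ses_elim hk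
    have hinj : Function.Injective g' := by
      rw [injective_iff_map_eq_zero]
      intro x hx
      obtain ⟨⟨y, hy⟩, rfl⟩ := (hfg' x).1 hx
      have : (⟨y, hy⟩ : LinearMap.ker (LinearMap.id : A →ₗ[R] A)) = 0 := Subtype.ext hy
      exact (congrArg f' this).trans (map_zero f')
    exact Or.inl (mem_iso hF (LinearEquiv.ofBijective g' ⟨hinj, hg'⟩).symm
      (mem_of0 hF hall _ hB'))
  | succ j ih =>
    intro A B C hs hA hB
    obtain ⟨f, g, hf, hg, hfg⟩ := ses_elim hs
    obtain ⟨P, hP, p, hp⟩ := hall A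
    obtain ⟨Q, hQ, q, hq⟩ := hall B
    have hk := ses_kernels f g hf hfg p.hom hp q.hom
    have hA' := dim_ker hF hall j _ _ A hP (ses_ker p.hom hp) hA
    have hB' := dim_ker hF hall (j + 1) _ _ B (hsum P Q hP hQ)
      (ses_ker ((f ∘ₗ p.hom).coprod q.hom)
        (fun b => by obtain ⟨y, hy⟩ := hq b; exact ⟨(0, y), by simpa using hy⟩)) hB
    exact ⟨_, Q, Or.inl hQ, ses_ker (g ∘ₗ q.hom) (hg.comp hq), ih _ _ _ hk hA' hB'⟩

theorem dim_sub (hF : DefinesHomDim F)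
    (hall : ∀ M : ModuleCat.{u} R, IsImageOfF F M)
    (hsum : ClosedUnderFinSums F) (j : ℕ) (A B C : ModuleCat.{u} R)
    (hs : IsSES A B C) (hB : FDimLE F j B) (hC : FDimLE F (j + 1) C) : FDimLE F j A := by
  cases j with
  | zero => exact dim_ker hF hall 0 A B C (mem_of0 hF hall B hB) hs hC
  | succ j =>
    obtain ⟨f, g, hf, hg, hfg⟩ := ses_elim hs
    obtain ⟨Q, hQ, q, hq⟩ := hall B
    have hk := ses_kernels2 f g hf hfg q.hom hq
    exact dim_quot hF hall hsum j _ _ _ hk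
      (dim_ker hF hall j _ _ B hQ (ses_ker q.hom hq) hB)
      (dim_ker hF hall (j + 1) _ _ C hQ (ses_ker (g ∘ₗ q.hom) (hg.comp hq)) hC)

theorem dim_dim (hF : DefinesHomDim F)
    (hall : ∀ M : ModuleCat.{u} R, IsImageOfF F M)
    (hsum : ClosedUnderFinSums F) (i m : ℕ) : ∀ X : ModuleCat.{u} R,
    FDimLE (FDimLE F i) m X → FDimLE F (i + m) X := by
  have h0 : ∀ X, MemF0 (FDimLE F i) X → FDimLE F i X :=
    fun X h => h.elim id (zero_dim F i X)
  induction m with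
  | zero => exact h0
  | succ m ih =>
    rintro X ⟨K, F0, hF0, hs, hK⟩
    exact dim_quot hF hall hsum (i + m) K F0 X hs (ih K hK)
      (dim_mono F (by omega) F0 (h0 F0 hF0))

theorem dim_kernel (hF : DefinesHomDim F)
    (hall : ∀ M : ModuleCat.{u} R, IsImageOfF F M)
    (hsum : ClosedUnderFinSums F) (i n : ℕ) : ∀ K X : ModuleCat.{u} R,
    FDimLE F (i + n + 1) X → IsFKernel (FDimLE F i) n K X → FDimLE F i K := by
  induction n with
  | zero =>
    rintro K X hX ⟨F0, h0, hs⟩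
    exact dim_sub hF hall hsum i K F0 X hs h0 hX
  | succ n ih =>
    rintro K X hX ⟨K1, F0, h0, hs, hk⟩
    exact ih K K1 (dim_sub hF hall hsum (i + n + 1) K1 F0 X hs
      (dim_mono F (by omega) F0 h0) hX) hk

end

theorem has_res {G : ModuleCat.{u} R → Prop} (hall : ∀ M : ModuleCat.{u} R, IsImageOfF G M)
    (M : ModuleCat.{u} R) : HasFRes G M := by
  have h : ∀ X : ModuleCat.{u} R, ∃ K F0 : ModuleCat.{u} R, MemF0 G F0 ∧ IsSES K F0 X := by
    intro X
    obtain ⟨F0, h0, g, hg⟩ := hall X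
    exact ⟨_, F0, Or.inl h0, ses_ker g.hom hg⟩
  choose N F0 h0 hs using h
  exact ⟨fun n => Nat.rec M (fun _ X => N X) n,
    fun n => F0 (Nat.rec M (fun _ X => N X) n), rfl, fun n => ⟨h0 _, hs _⟩⟩

end HD

theorem stmt13 {R : Type u} [Ring R] (F : ModuleCat.{u} R → Prop)
    (hF : DefinesHomDim F) (hsum : ClosedUnderFinSums F)
    (hall : ∀ M : ModuleCat.{u} R, IsImageOfF F M)
    (i : ℕ) (hi : 1 ≤ i) :
    DefinesHomDim (FDimLE F i) := by
  refine ⟨fun K _ _ _ _ _ => HD.has_res (fun M => ?_) K, fun n K X hX hK => ?_⟩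
  · obtain ⟨F0, h0, g, hg⟩ := hall M
    exact ⟨F0, HD.dim_of_mem F i F0 (Or.inl h0), g, hg⟩
  · exact HD.dim_kernel hF hall hsum i n K X (HD.dim_dim hF hall hsum i (n + 1) X hX) hK
end

section
/- Let R be a commutative noetherian ring and M a finitely generated R-module of finite G(R)-dimension n (i.e., admitting a G(R)-resolution of length n but none shorter). Then n = sup{i : Ext^i_R(M, R) ≠ 0}. In particular, if M has finite G(R)-dimension and Ext^i_R(M, R) = 0 for all i > k, then M has G(R)-dimension ≤ k. -/
open CategoryTheory

universe u

/-- The Auslander `G`-class `G(R)`. -/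
def GClass {R : Type u} [CommRing R] (M : ModuleCat.{u} R) : Prop :=
  Module.Finite R M ∧
  (∀ m : ℕ, 0 < m → ExtZero m M (ModuleCat.of R R)) ∧
  (∀ m : ℕ, 0 < m → ExtZero m (ModuleCat.of R (Module.Dual R M)) (ModuleCat.of R R)) ∧
  Function.Bijective (Module.Dual.eval R M)

section helpers

theorem aux_ext_iff {R : Type u} [CommRing R] (n : ℕ) (M N : ModuleCat.{u} R) :
    ExtZero (n + 1) M N ↔ Subsingleton (Abelian.Ext.{u} M N (n + 1)) := by
  let P : ProjectiveResolution M := projectiveResolution M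
  have key : ExtZero (n + 1) M N ↔ ∀ f : P.complex.X (n + 1) ⟶ N,
      P.complex.d (n + 2) (n + 1) ≫ f = 0 → ∃ g, P.complex.d (n + 1) n ≫ g = f := by
    unfold ExtZero
    rw [← ModuleCat.isZero_iff_subsingleton, (P.isoExt (n + 1) N).isZero_iff,
      ← HomologicalComplex.exactAt_iff_isZero_homology,
      HomologicalComplex.exactAt_iff' _ n (n + 1) (n + 2) (by simp) (by simp),
      ShortComplex.moduleCat_exact_iff]
    rfl
  rw [key]
  constructor
  · intro h
    refine subsingleton_of_forall_eq 0 fun x => ?_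
    obtain ⟨f, hf, rfl⟩ := P.extMk_surjective x (n + 2) rfl
    rw [P.extMk_eq_zero_iff f (n + 2) rfl hf n rfl]
    exact h f hf
  · intro h f hf
    rw [← P.extMk_eq_zero_iff f (n + 2) rfl hf n rfl]
    exact Subsingleton.elim _ _

theorem aux_ses {R : Type u} [CommRing R] {A B C : ModuleCat.{u} R} (f : A ⟶ B) (g : B ⟶ C)
    (hf : Function.Injective f) (hg : Function.Surjective g) (h : Function.Exact f g) :
    ∃ w : f ≫ g = 0, (ShortComplex.mk f g w).ShortExact := by
  have w : f ≫ g = 0 := by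
    ext x
    exact h.apply_apply_eq_zero x
  refine ⟨w, ?_⟩
  have hmono := (ModuleCat.mono_iff_injective f).2 hf
  have := (ModuleCat.epi_iff_surjective g).2 hg
  exact { exact := (ShortComplex.ShortExact.moduleCat_exact_iff_function_exact _).2 h
          mono_f := hmono
          epi_g := this }

theorem aux_shift_up {R : Type u} [CommRing R] {A B C N : ModuleCat.{u} R} (h : IsSES A B C)
    (n : ℕ) (hB : ExtZero (n + 2) B N) (hA : ExtZero (n + 1) A N) : ExtZero (n + 2) C N := by
  obtain ⟨f, g, hf, hg, hfg⟩ := h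
  obtain ⟨w, hS⟩ := aux_ses f g hf hg hfg
  rw [aux_ext_iff] at *
  refine subsingleton_of_forall_eq 0 fun x => ?_
  obtain ⟨y, hy⟩ := Abelian.Ext.contravariant_sequence_exact₃ hS N x
    (hB.elim _ _) (n₀ := n + 1) (by omega)
  rw [← hy, hA.elim y 0, Abelian.Ext.comp_zero]

theorem aux_shift_down {R : Type u} [CommRing R] {A B C N : ModuleCat.{u} R} (h : IsSES A B C)
    (n : ℕ) (hB : ExtZero (n + 1) B N) (hC : ExtZero (n + 2) C N) : ExtZero (n + 1) A N := by
  obtain ⟨f, g, hf, hg, hfg⟩ := h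
  obtain ⟨w, hS⟩ := aux_ses f g hf hg hfg
  rw [aux_ext_iff] at *
  refine subsingleton_of_forall_eq 0 fun x => ?_
  obtain ⟨y, hy⟩ := Abelian.Ext.contravariant_sequence_exact₁ hS N x
    (n₁ := n + 2) (by omega) (hC.elim _ _)
  rw [← hy, hB.elim y 0, Abelian.Ext.comp_zero]

theorem aux_lift {R : Type u} [CommRing R] {A B C N : ModuleCat.{u} R} (f : A ⟶ B) (g : B ⟶ C)
    (hf : Function.Injective f) (hg : Function.Surjective g) (hfg : Function.Exact f g)
    (hC : ExtZero 1 C N) (a : A ⟶ N) : ∃ b : B ⟶ N, f ≫ b = a := by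
  obtain ⟨w, hS⟩ := aux_ses f g hf hg hfg
  rw [aux_ext_iff] at hC
  obtain ⟨y, hy⟩ := Abelian.Ext.contravariant_sequence_exact₁ hS N (Abelian.Ext.mk₀ a)
    (n₁ := 1) (by omega) (hC.elim _ _)
  obtain ⟨b, rfl⟩ := Abelian.Ext.homEquiv₀.symm.surjective y
  refine ⟨b, ?_⟩
  apply Abelian.Ext.homEquiv₀.symm.injective
  simpa using hy

theorem aux_ext_zero {R : Type u} [CommRing R] (M N : ModuleCat.{u} R) [Subsingleton M] (n : ℕ) :
    ExtZero (n + 1) M N := by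
  rw [aux_ext_iff]
  have : Limits.IsZero M := ModuleCat.isZero_of_subsingleton M
  have : Projective M := this.projective
  refine subsingleton_of_forall_eq 0 fun x => Abelian.Ext.eq_zero_of_projective x

theorem aux_mem {R : Type u} [CommRing R] (M : ModuleCat.{u} R) (h : MemF0 GClass M) :
    GClass M := by
  rcases h with h | h
  · exact h
  · have : Subsingleton (Module.Dual R M) := ⟨fun a b => by
      ext x; rw [Subsingleton.elim x 0, map_zero, map_zero]⟩
    have h3 : Subsingleton (Module.Dual R (Module.Dual R M)) := ⟨fun a b => by
      ext x; rw [Subsingleton.elim x 0, map_zero, map_zero]⟩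
    refine ⟨inferInstance, ?_, ?_, fun _ _ _ => Subsingleton.elim _ _,
      fun _ => ⟨0, Subsingleton.elim _ _⟩⟩
    · rintro (_ | m) hm
      · omega
      · exact aux_ext_zero _ _ _
    · rintro (_ | m) hm
      · omega
      · have : Subsingleton (ModuleCat.of R (Module.Dual R M)) := this
        exact aux_ext_zero _ _ _

theorem aux_ext_gt {R : Type u} [CommRing R] (n : ℕ) : ∀ (M : ModuleCat.{u} R),
    FDimLE GClass n M → ∀ i, n < i → ExtZero i M (ModuleCat.of R R) := by
  induction n with
  | zero => exact fun M h i hi => (aux_mem M h).2.1 i hi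
  | succ n ih =>
    rintro M ⟨K, F, hF, hs, hK⟩ i hi
    obtain ⟨j, rfl⟩ : ∃ j, i = j + 2 := ⟨i - 2, by omega⟩
    exact aux_shift_up hs j ((aux_mem F hF).2.1 _ (by omega)) (ih K hK _ (by omega))

theorem aux_step {R : Type u} [CommRing R] {K F M : ModuleCat.{u} R} (hK : GClass K)
    (hF : GClass F) (hs : IsSES K F M)
    (hM : ∀ i, 0 < i → ExtZero i M (ModuleCat.of R R)) : GClass M := by
  obtain ⟨f, g, hf, hg, hfg⟩ := hs
  have hsur : Function.Surjective f.hom.dualMap := by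
    intro a
    obtain ⟨b, hb⟩ := aux_lift f g hf hg hfg (hM 1 one_pos) (ModuleCat.ofHom a)
    refine ⟨b.hom, ?_⟩
    have := congrArg ModuleCat.Hom.hom hb
    exact this
  have hinj : Function.Injective g.hom.dualMap := LinearMap.dualMap_injective_of_surjective hg
  have hex : Function.Exact g.hom.dualMap f.hom.dualMap := by
    intro φ
    constructor
    · intro h
      have hk : LinearMap.ker g.hom ≤ LinearMap.ker φ := by
        intro x hx
        obtain ⟨y, rfl⟩ := (hfg x).1 hx
        exact LinearMap.congr_fun h y
      have e := g.hom.quotKerEquivOfSurjective hg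
      refine ⟨(LinearMap.ker g.hom).liftQ φ hk ∘ₗ
        (g.hom.quotKerEquivOfSurjective hg).symm.toLinearMap, ?_⟩
      ext x
      have : (g.hom.quotKerEquivOfSurjective hg).symm (g.hom x) = Submodule.Quotient.mk x := by
        rw [LinearEquiv.symm_apply_eq]; rfl
      simp [LinearMap.dualMap_apply, this]
    · rintro ⟨ψ, rfl⟩
      ext x
      have : g.hom (f.hom x) = 0 := hfg.apply_apply_eq_zero x
      simp [this]
  have hsd : IsSES (ModuleCat.of R (Module.Dual R M)) (ModuleCat.of R (Module.Dual R F))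
      (ModuleCat.of R (Module.Dual R K)) :=
    ⟨ModuleCat.ofHom g.hom.dualMap, ModuleCat.ofHom f.hom.dualMap, hinj, hsur, hex⟩
  have hsur2 : Function.Surjective g.hom.dualMap.dualMap := by
    intro a
    obtain ⟨b, hb⟩ := aux_lift (A := ModuleCat.of R (Module.Dual R M))
      (B := ModuleCat.of R (Module.Dual R F)) (C := ModuleCat.of R (Module.Dual R K))
      (N := ModuleCat.of R R)
      (ModuleCat.ofHom g.hom.dualMap) (ModuleCat.ofHom f.hom.dualMap)
      hinj hsur hex (hK.2.2.1 1 one_pos) (ModuleCat.ofHom a)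
    refine ⟨b.hom, ?_⟩
    have := congrArg ModuleCat.Hom.hom hb
    exact this
  have := hF.1
  have nat : ∀ x, Module.Dual.eval R M (g.hom x) = g.hom.dualMap.dualMap (Module.Dual.eval R F x) :=
    fun x => rfl
  refine ⟨Module.Finite.of_surjective g.hom hg, hM, ?_, ?_, ?_⟩
  · rintro (_ | m) hm
    · omega
    · exact aux_shift_down hsd m (hF.2.2.1 _ (by omega)) (hK.2.2.1 _ (by omega))
  · rw [injective_iff_map_eq_zero]
    intro y hy
    obtain ⟨x, rfl⟩ := hg y
    -- the evaluation functional at `x` kills the image of the dual of `M`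
    have hx : ∀ ψ : Module.Dual R M, ψ (g.hom x) = 0 := fun ψ => LinearMap.congr_fun hy ψ
    have hk : LinearMap.ker f.hom.dualMap ≤ LinearMap.ker (Module.Dual.eval R F x) := by
      intro φ hφ
      obtain ⟨ψ, rfl⟩ := (hex φ).1 hφ
      exact hx ψ
    let θ : Module.Dual R (Module.Dual R K) :=
      (LinearMap.ker f.hom.dualMap).liftQ (Module.Dual.eval R F x) hk ∘ₗ
        (f.hom.dualMap.quotKerEquivOfSurjective hsur).symm.toLinearMap
    obtain ⟨z, hz⟩ := hK.2.2.2.2 θ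
    have hxz : f.hom z = x := by
      apply hF.2.2.2.1
      ext φ
      have h1 : (f.hom.dualMap.quotKerEquivOfSurjective hsur).symm (f.hom.dualMap φ)
          = Submodule.Quotient.mk φ := by
        rw [LinearEquiv.symm_apply_eq]; rfl
      have h2 : θ (f.hom.dualMap φ) = φ x := by
        change (LinearMap.ker f.hom.dualMap).liftQ (Module.Dual.eval R F x) hk
          ((f.hom.dualMap.quotKerEquivOfSurjective hsur).symm (f.hom.dualMap φ)) = φ x
        rw [h1]; rfl
      rw [← hz] at h2
      exact h2
    rw [← hxz]
    exact hfg.apply_apply_eq_zero z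
  · intro α
    obtain ⟨β, rfl⟩ := hsur2 α
    obtain ⟨x, rfl⟩ := hF.2.2.2.2 β
    exact ⟨g.hom x, nat x⟩

theorem aux_zero {R : Type u} [CommRing R] (n : ℕ) : ∀ (M : ModuleCat.{u} R),
    FDimLE GClass n M → (∀ i, 0 < i → ExtZero i M (ModuleCat.of R R)) → GClass M := by
  induction n with
  | zero => exact fun M h _ => aux_mem M h
  | succ n ih =>
    rintro M ⟨K, F, hF, hs, hK⟩ hM
    have hF := aux_mem F hF
    refine aux_step (ih K hK ?_) hF hs hM
    rintro (_ | m) hm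
    · omega
    · exact aux_shift_down hs m (hF.2.1 _ (by omega)) (hM _ (by omega))

theorem aux_mono {R : Type u} [CommRing R] (n : ℕ) : ∀ (M : ModuleCat.{u} R),
    FDimLE GClass n M → FDimLE GClass (n + 1) M := by
  induction n with
  | zero =>
    intro M h
    refine ⟨ModuleCat.of R PUnit, M, h, ⟨0, 𝟙 M, fun _ _ _ => Subsingleton.elim _ _,
      fun x => ⟨x, rfl⟩, ?_⟩, Or.inr (inferInstanceAs (Subsingleton PUnit))⟩
    intro x
    constructor
    · intro hx
      exact ⟨0, hx.symm⟩
    · rintro ⟨y, rfl⟩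
      rfl
  | succ n ih =>
    rintro M ⟨K, F, hF, hs, hK⟩
    exact ⟨K, F, hF, hs, ih K hK⟩

theorem aux_main {R : Type u} [CommRing R] (k : ℕ) : ∀ (n : ℕ) (M : ModuleCat.{u} R),
    FDimLE GClass n M → (∀ i, k < i → ExtZero i M (ModuleCat.of R R)) → FDimLE GClass k M := by
  induction k with
  | zero => exact fun n M h hM => Or.inl (aux_zero n M h hM)
  | succ k ih =>
    intro n M h hM
    obtain ⟨K, F, hF, hs, hK⟩ := aux_mono n M h
    refine ⟨K, F, hF, hs, ih n K hK ?_⟩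
    intro i hi
    obtain ⟨j, rfl⟩ : ∃ j, i = j + 1 := ⟨i - 1, by omega⟩
    exact aux_shift_down hs j ((aux_mem F hF).2.1 _ (by omega)) (hM _ (by omega))

end helpers

theorem stmt18 {R : Type u} [CommRing R] [IsNoetherianRing R]
    (M : ModuleCat.{u} R) (hfin : Module.Finite R M) (n : ℕ)
    (hn : FDimLE GClass n M) (hmin : ∀ m : ℕ, m < n → ¬ FDimLE GClass m M) :
    n = sSup {i : ℕ | ¬ ExtZero i M (ModuleCat.of R R)} ∧
    ∀ k : ℕ, (∀ i : ℕ, k < i → ExtZero i M (ModuleCat.of R R)) →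
      FDimLE GClass k M := by
  refine ⟨?_, fun k hk => aux_main k n M hn hk⟩
  have hub : ∀ i ∈ {i : ℕ | ¬ ExtZero i M (ModuleCat.of R R)}, i ≤ n := by
    intro i hi
    by_contra hlt
    exact hi (aux_ext_gt n M hn i (by omega))
  apply le_antisymm
  · rcases n with _ | n
    · exact Nat.zero_le _
    · apply le_csSup ⟨n + 1, hub⟩
      intro hz
      refine hmin n (by omega) (aux_main n (n + 1) M hn ?_)
      intro i hi
      rcases Nat.lt_or_ge (n + 1) i with h | h
      · exact aux_ext_gt (n + 1) M hn i h
      · obtain rfl : i = n + 1 := by omega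
        exact hz
  · rcases Set.eq_empty_or_nonempty {i : ℕ | ¬ ExtZero i M (ModuleCat.of R R)} with h | h
    · rw [h]; simp
    · exact csSup_le h hub
end
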